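/- arXiv:1604.02755 — 3 statements merged into one kernel-verified Lean document; each statement's English description precedes it below -/
import Mathlib

section
/- For every natural number n such that ⌊0.6535·n⌋ ≥ 6, K(n, 4) ≥ 40 · 3^((⌊0.6535·n⌋ − 8)/3), where the right-hand side is a real power and K is compared as a real number. -/
/-- The cyclic distance between two positions on a cycle of length `N`:
the minimum of the two arc lengths. -/
def cycDist {N : ℕ} (i j : ZMod N) : ℕ := min (j - i).val (i - j).val

/-- `C` is an `(n,k)` circuit code of length `N`: a cyclic sequence of `N` distinct
vertices of the hypercube `I(n)` forming an induced cycle such that vertices at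
Hamming distance `< k` are at equal cyclic distance. -/
structure IsCircuitCode (n k N : ℕ) (C : ZMod N → (Fin n → Bool)) : Prop where
  inj : Function.Injective C
  adj : ∀ i : ZMod N, hammingDist (C i) (C (i + 1)) = 1
  induced : ∀ i j : ZMod N, i ≠ j → j ≠ i + 1 → i ≠ j + 1 →
    hammingDist (C i) (C j) ≠ 1
  spread : ∀ i j : ZMod N, hammingDist (C i) (C j) < k →
    cycDist i j = hammingDist (C i) (C j)

/-- There exists an `(n,k)` circuit code of length `N`. -/
def ExistsCircuitCode (n k N : ℕ) : Prop :=
  ∃ C : ZMod N → (Fin n → Bool), IsCircuitCode n k N C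

/-- `K n k` is the maximum length of an `(n,k)` circuit code. -/
noncomputable def K (n k : ℕ) : ℕ := sSup {N | ExistsCircuitCode n k N}

/-- A bi-infinite `N`-periodic walk in the hypercube such that vertices at Hamming distance `< 4`
are at most as far apart along the cycle. -/
structure IsPeriodicCode (n : ℕ) (N : ℤ) (c : ℤ → Fin n → Bool) : Prop where
  periodic : ∀ i m : ℤ, c (i + m * N) = c i
  step : ∀ i, hammingDist (c i) (c (i + 1)) ≤ 1
  spread : ∀ i j, hammingDist (c i) (c j) < 4 →
    ∃ m : ℤ, |i - j - m * N| ≤ hammingDist (c i) (c j)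

namespace IsPeriodicCode

variable {n : ℕ} {N : ℤ} {c : ℤ → Fin n → Bool}

lemma hammingDist_add_le (h : IsPeriodicCode n N c) (i : ℤ) (d : ℕ) :
    hammingDist (c i) (c (i + d)) ≤ d := by
  induction d with
  | zero => simp
  | succ d ih =>
    have h1 := hammingDist_triangle (c i) (c (i + d)) (c (i + (d + 1 : ℕ)))
    have h2 := h.step (i + d)
    rw [add_assoc] at h2
    push_cast at h1 ⊢
    omega

lemma hammingDist_le_abs (h : IsPeriodicCode n N c) (i j : ℤ) :
    (hammingDist (c i) (c j) : ℤ) ≤ |i - j| := by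
  rcases le_total i j with hij | hij
  · have := h.hammingDist_add_le i (j - i).toNat
    rw [Int.toNat_of_nonneg (by omega), add_sub_cancel] at this
    rw [abs_of_nonpos (by omega)]
    omega
  · have := h.hammingDist_add_le j (i - j).toNat
    rw [Int.toNat_of_nonneg (by omega), add_sub_cancel, hammingDist_comm] at this
    rw [abs_of_nonneg (by omega)]
    omega

lemma eq_of_emod_eq (h : IsPeriodicCode n N c) {i j : ℤ} (hij : i % N = j % N) : c i = c j := by
  have hi := h.periodic (i % N) (i / N)
  have hj := h.periodic (j % N) (j / N)
  rw [mul_comm, Int.emod_add_mul_ediv] at hi hj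
  rw [hi, hj, hij]

lemma hammingDist_le_abs_sub_mul (h : IsPeriodicCode n N c) (i j m : ℤ) :
    (hammingDist (c i) (c j) : ℤ) ≤ |i - j - m * N| := by
  rw [← h.periodic j m, sub_sub]
  exact h.hammingDist_le_abs _ _

end IsPeriodicCode

lemma natCast_val_sub {N : ℕ} [NeZero N] (i j : ZMod N) :
    ((i - j).val : ℤ) = ((i.val : ℤ) - j.val) % N := by
  rw [← ZMod.val_intCast]
  simp

lemma emod_eq_of_sub_emod {N x y d : ℤ} (h : d = (x - y) % N) : ∃ m, x - y = d + m * N :=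
  ⟨(x - y) / N, by rw [h, mul_comm, Int.emod_add_mul_ediv]⟩

lemma emod_le_self_of_nonneg {x N : ℤ} (hN : 0 ≤ N) (hx : 0 ≤ x) : x % N ≤ x := by
  have h1 := Int.emod_add_mul_ediv x N
  have h2 := mul_nonneg hN (Int.ediv_nonneg hx hN)
  omega

lemma IsPeriodicCode.existsCircuitCode {n N : ℕ} {c : ℤ → Fin n → Bool}
    (h : IsPeriodicCode n N c) (hN : 2 ≤ N) : ExistsCircuitCode n 4 N := by
  have : NeZero N := ⟨by omega⟩
  have key : ∀ i j : ZMod N, hammingDist (c i.val) (c j.val) < 4 →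
      cycDist i j = hammingDist (c i.val) (c j.val) := by
    intro i j hd
    obtain ⟨m, hm⟩ := h.spread _ _ hd
    have hij := natCast_val_sub i j
    have hji := natCast_val_sub j i
    obtain ⟨a, ha⟩ := emod_eq_of_sub_emod hij
    obtain ⟨b, hb⟩ := emod_eq_of_sub_emod hji
    have h1 := h.hammingDist_le_abs_sub_mul i.val j.val a
    have h2 := h.hammingDist_le_abs_sub_mul j.val i.val b
    rw [hammingDist_comm] at h2
    rw [ha, add_sub_cancel_right, abs_of_nonneg (by positivity)] at h1
    rw [hb, add_sub_cancel_right, abs_of_nonneg (by positivity)] at h2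
    have h3 : cycDist i j ≤ hammingDist (c i.val) (c j.val) := by
      unfold cycDist
      rw [abs_le] at hm
      rcases le_total 0 ((i.val : ℤ) - j.val - m * N) with h0 | h0
      · have : ((i - j).val : ℤ) ≤ (i.val : ℤ) - j.val - m * N := by
          rw [hij, ← Int.sub_mul_emod_self_right _ m]
          exact emod_le_self_of_nonneg (by positivity) h0
        omega
      · have : ((j - i).val : ℤ) ≤ (j.val : ℤ) - i.val - (-m) * N := by
          rw [hji, ← Int.sub_mul_emod_self_right _ (-m)]
          exact emod_le_self_of_nonneg (by positivity) (by linarith)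
        rw [neg_mul] at this
        omega
    unfold cycDist at h3 ⊢
    omega
  have cyc_zero : ∀ i j : ZMod N, cycDist i j = 0 → i = j := by
    intro i j hc
    unfold cycDist at hc
    rcases min_eq_iff.mp hc with ⟨h0, _⟩ | ⟨h0, _⟩
    · exact (sub_eq_zero.mp ((ZMod.val_eq_zero _).mp h0)).symm
    · exact sub_eq_zero.mp ((ZMod.val_eq_zero _).mp h0)
  have val_one : ∀ i : ZMod N, i.val = 1 → i = 1 := by
    intro i hi
    rw [← ZMod.natCast_zmod_val i, hi, Nat.cast_one]
  have inj : Function.Injective fun i : ZMod N => c i.val := by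
    intro i j hc
    have h0 : hammingDist (c i.val) (c j.val) = 0 := hammingDist_eq_zero.mpr hc
    exact cyc_zero i j ((key i j (by omega)).trans h0)
  refine ⟨fun i => c i.val, inj, ?_, ?_, key⟩
  · intro i
    have h1 : c ((i + 1).val : ℤ) = c ((i.val : ℤ) + 1) := by
      apply h.eq_of_emod_eq
      rw [← ZMod.intCast_eq_intCast_iff']
      simp
    have h2 : hammingDist (c i.val) (c ((i + 1).val : ℤ)) ≠ 0 := by
      intro h0
      have : Fact (1 < N) := ⟨by omega⟩
      have := inj (hammingDist_eq_zero.mp h0)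
      simp at this
    have h3 := h.step i.val
    rw [← h1] at h3
    show hammingDist (c i.val) (c ((i + 1).val : ℤ)) = 1
    omega
  · intro i j _ hji hij hd
    have hc := (key i j (by show hammingDist (c i.val) (c j.val) < 4; omega)).trans hd
    unfold cycDist at hc
    rcases min_eq_iff.mp hc with ⟨h1, _⟩ | ⟨h1, _⟩
    · exact hji (by rw [← val_one _ h1]; ring)
    · exact hij (by rw [← val_one _ h1]; ring)

lemma le_K {n k N : ℕ} (h : ExistsCircuitCode n k N) : N ≤ K n k := by
  refine le_csSup ⟨2 ^ n, ?_⟩ h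
  rintro M ⟨C, hC⟩
  rcases Nat.eq_zero_or_pos M with rfl | hM
  · exact Nat.zero_le _
  · have : NeZero M := ⟨hM.ne'⟩
    simpa [ZMod.card] using Fintype.card_le_of_injective C hC.inj

lemma hammingDist_append {m n : ℕ} (u u' : Fin m → Bool) (v v' : Fin n → Bool) :
    hammingDist (Fin.append u v) (Fin.append u' v') = hammingDist u u' + hammingDist v v' := by
  simp [hammingDist, Finset.card_filter, Fin.sum_univ_add]

/-- The cycle of length `2 n` in the `n`-cube which flips the coordinates one after the other. -/
def cyclicFlip (n : ℕ) (t : ℤ) (i : Fin n) : Bool := decide ((t - (i : ℤ)) % (2 * n) < n)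

lemma cyclicFlip_emod (n : ℕ) (t : ℤ) : cyclicFlip n (t % (2 * n)) = cyclicFlip n t := by
  funext i
  simp [cyclicFlip, Int.sub_emod]

lemma cyclicFlip_isPeriodicCode {n : ℕ} (hn : 0 < n)
    (step : ∀ a : Fin (2 * n), hammingDist (cyclicFlip n (a : ℕ)) (cyclicFlip n ((a : ℕ) + 1)) ≤ 1)
    (spread : ∀ a b : Fin (2 * n),
      hammingDist (cyclicFlip n (a : ℕ)) (cyclicFlip n (b : ℕ)) < 4 → b.val ≤ a.val →
      min (a.val - b.val) (2 * n - (a.val - b.val)) ≤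
        hammingDist (cyclicFlip n (a : ℕ)) (cyclicFlip n (b : ℕ))) :
    IsPeriodicCode n (2 * n : ℕ) (cyclicFlip n) := by
  have res : ∀ t : ℤ, ∃ (a : Fin (2 * n)) (q : ℤ), t = (a : ℕ) + q * (2 * n : ℕ) := by
    intro t
    have h0 := Int.emod_nonneg t (b := (2 * n : ℕ)) (by omega)
    have h1 := Int.emod_lt_of_pos t (b := (2 * n : ℕ)) (by omega)
    refine ⟨⟨(t % (2 * n : ℕ)).toNat, by omega⟩, t / (2 * n : ℕ), ?_⟩
    show t = (((t % (2 * n : ℕ)).toNat : ℕ) : ℤ) + _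
    rw [Int.toNat_of_nonneg h0, mul_comm (t / _), Int.emod_add_mul_ediv]
  have per : ∀ i m : ℤ, cyclicFlip n (i + m * (2 * n : ℕ)) = cyclicFlip n i := by
    intro i m
    rw [← cyclicFlip_emod, ← cyclicFlip_emod n i]
    push_cast
    rw [Int.add_mul_emod_self_right]
  refine ⟨per, ?_, ?_⟩
  · intro i
    obtain ⟨a, q, rfl⟩ := res i
    rw [add_right_comm, per, per]
    exact step a
  · intro i j
    obtain ⟨a, q, rfl⟩ := res i
    obtain ⟨b, r, rfl⟩ := res j
    rw [per, per]
    intro hd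
    have ha := a.isLt
    have hb := b.isLt
    have rw_sub : ∀ e : ℤ, ((a : ℕ) : ℤ) + q * (2 * n : ℕ) - ((b : ℕ) + r * (2 * n : ℕ))
        - (q - r + e) * (2 * n : ℕ) = (a : ℕ) - (b : ℕ) - e * (2 * n : ℕ) := by
      intro e; ring
    have main : ∃ e : ℤ, |((a : ℕ) : ℤ) - (b : ℕ) - e * (2 * n : ℕ)| ≤
        hammingDist (cyclicFlip n (a : ℕ)) (cyclicFlip n (b : ℕ)) := by
      rcases le_total b.val a.val with hba | hba
      · have := spread a b hd hba
        rcases min_le_iff.mp this with h1 | h1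
        · exact ⟨0, by rw [abs_le]; omega⟩
        · exact ⟨1, by rw [abs_le]; omega⟩
      · rw [hammingDist_comm] at hd ⊢
        have := spread b a hd hba
        rcases min_le_iff.mp this with h1 | h1
        · exact ⟨0, by rw [abs_le]; omega⟩
        · exact ⟨-1, by rw [abs_le]; omega⟩
    obtain ⟨e, he⟩ := main
    exact ⟨q - r + e, by rw [rw_sub]; exact he⟩

lemma cyclicFlip_five : IsPeriodicCode 5 (2 * 5 : ℕ) (cyclicFlip 5) :=
  cyclicFlip_isPeriodicCode (by norm_num) (by decide +kernel) (by decide +kernel)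

lemma cyclicFlip_six : IsPeriodicCode 6 (2 * 6 : ℕ) (cyclicFlip 6) :=
  cyclicFlip_isPeriodicCode (by norm_num) (by decide +kernel) (by decide +kernel)

lemma cyclicFlip_seven : IsPeriodicCode 7 (2 * 7 : ℕ) (cyclicFlip 7) :=
  cyclicFlip_isPeriodicCode (by norm_num) (by decide +kernel) (by decide +kernel)

lemma cyclicFlip_eight : IsPeriodicCode 8 (2 * 8 : ℕ) (cyclicFlip 8) :=
  cyclicFlip_isPeriodicCode (by norm_num) (by decide +kernel) (by decide +kernel)

lemma cyclicFlip_nine : IsPeriodicCode 9 (2 * 9 : ℕ) (cyclicFlip 9) :=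
  cyclicFlip_isPeriodicCode (by norm_num) (by decide +kernel) (by decide +kernel)

/-- The vertical coordinate `⌊t A / (N + A)⌋` of a balanced staircase of slope `A / N ≤ 1` grows
at most one faster than the horizontal one. -/
lemma abs_staircase_le {N A : ℤ} (hA : 0 < A) (hAN : A ≤ N) (s t : ℤ) :
    |t * A / (N + A) - s * A / (N + A)| ≤
      |(t - t * A / (N + A)) - (s - s * A / (N + A))| + 1 := by
  have aux : ∀ s t : ℤ, s ≤ t → |t * A / (N + A) - s * A / (N + A)| ≤
      |(t - t * A / (N + A)) - (s - s * A / (N + A))| + 1 := by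
    intro s t hst
    have hS : 0 < N + A := by omega
    have h1 := Int.emod_add_mul_ediv (t * A) (N + A)
    have h2 := Int.emod_add_mul_ediv (s * A) (N + A)
    have h3 := Int.emod_nonneg (t * A) hS.ne'
    have h4 := Int.emod_lt_of_pos (s * A) hS
    have h5 := Int.emod_nonneg (s * A) hS.ne'
    have h6 := Int.emod_lt_of_pos (t * A) hS
    set y := t * A / (N + A)
    set z := s * A / (N + A)
    have hmono : z ≤ y := Int.ediv_le_ediv hS (by nlinarith)
    have hup : 2 * (y - z) < (t - s) + 2 := by
      by_contra! hc
      nlinarith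
    rw [abs_of_nonneg (by omega)]
    have := le_abs_self ((t - y) - (s - z))
    omega
  rcases le_total s t with h | h
  · exact aux s t h
  · rw [abs_sub_comm, abs_sub_comm (t - _)]
    exact aux t s h

lemma staircase_add_mul {N A : ℤ} (hS : N + A ≠ 0) (t m : ℤ) :
    (t + m * (N + A)) * A / (N + A) = t * A / (N + A) + m * A := by
  rw [show (t + m * (N + A)) * A = t * A + m * A * (N + A) by ring,
    Int.add_mul_ediv_right _ _ hS]

/-- A staircase on the torus formed by a spread `4` code of length `N` and the cycle of length `10`
in the `5`-cube. -/
lemma IsPeriodicCode.staircase {n : ℕ} {N : ℤ} {c : ℤ → Fin n → Bool}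
    (h : IsPeriodicCode n N c) {a : ℤ} (ha : 0 ≤ a) (haN : 10 * a + 5 ≤ N) :
    ∃ c' : ℤ → Fin (n + 5) → Bool, IsPeriodicCode (n + 5) (2 * (N + (10 * a + 5))) c' := by
  obtain ⟨A, hA⟩ : ∃ A, A = 10 * a + 5 := ⟨_, rfl⟩
  rw [← hA] at haN ⊢
  have hA0 : 0 < A := by omega
  have hS : 0 < N + A := by omega
  have d := cyclicFlip_five
  refine ⟨fun t => Fin.append (c (t - t * A / (N + A))) (cyclicFlip 5 (t * A / (N + A))),
    ?_, ?_, ?_⟩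
  · intro i m
    have h1 := staircase_add_mul hS.ne' i (2 * m)
    rw [show i + m * (2 * (N + A)) = i + 2 * m * (N + A) by ring, h1]
    rw [show i + 2 * m * (N + A) - (i * A / (N + A) + 2 * m * A) =
      i - i * A / (N + A) + 2 * m * N by ring, h.periodic,
      show 2 * m * A = m * (2 * a + 1) * (2 * 5 : ℕ) by rw [hA]; push_cast; ring, d.periodic]
  · intro i
    rw [hammingDist_append]
    have hle : i * A / (N + A) ≤ (i + 1) * A / (N + A) := Int.ediv_le_ediv hS (by nlinarith)
    have hge : (i + 1) * A / (N + A) ≤ i * A / (N + A) + 1 := by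
      have h1 := Int.add_mul_ediv_right (i * A) 1 hS.ne'
      rw [← h1]
      exact Int.ediv_le_ediv hS (by nlinarith)
    obtain hy | hy : (i + 1) * A / (N + A) = i * A / (N + A) ∨
        (i + 1) * A / (N + A) = i * A / (N + A) + 1 := by omega
    · rw [hy, hammingDist_self, add_sub_right_comm]
      exact h.step _
    · rw [hy, add_sub_add_right_eq_sub, hammingDist_self, zero_add]
      exact d.step _
  · intro i j
    rw [hammingDist_append]
    intro hd
    obtain ⟨m, hm⟩ := h.spread (i - i * A / (N + A)) (j - j * A / (N + A)) (by omega)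
    obtain ⟨r, hr⟩ := d.spread (i * A / (N + A)) (j * A / (N + A)) (by omega)
    have hb := abs_staircase_le hA0 haN (j + m * (N + A)) i
    rw [staircase_add_mul hS.ne'] at hb
    generalize hammingDist (c _) (c _) = h₁ at *
    generalize hammingDist (cyclicFlip 5 _) (cyclicFlip 5 _) = h₂ at *
    generalize i * A / (N + A) = y at *
    generalize j * A / (N + A) = z at *
    rw [show i - y - (j + m * (N + A) - (z + m * A)) = i - y - (j - z) - m * N by ring] at hb
    obtain ⟨M, hM⟩ : ∃ M, M = m * N := ⟨_, rfl⟩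
    obtain ⟨B, hB⟩ : ∃ B, B = m * a := ⟨_, rfl⟩
    have hmA : m * A = 10 * B + 5 * m := by rw [hA, hB]; ring
    rw [← hM] at hm hb
    rw [hmA] at hb
    push_cast at hr
    have hq : m = 2 * (r - B) := by
      rw [abs_le] at hm hr
      rcases abs_cases (y - (z + (10 * B + 5 * m))) with ⟨h1, _⟩ | ⟨h1, _⟩ <;>
      rcases abs_cases (i - y - (j - z) - M) with ⟨h2, _⟩ | ⟨h2, _⟩ <;>
      omega
    refine ⟨r - B, ?_⟩
    rw [show (r - B) * (2 * (N + A)) = M + (10 * B + 5 * m) by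
      rw [hM, ← hmA, hq]; ring]
    rw [abs_le] at hm hr ⊢
    push_cast
    omega

lemma IsPeriodicCode.exists_longer {n N : ℕ} {c : ℤ → Fin n → Bool}
    (h : IsPeriodicCode n N c) (hN : 5 ≤ N) :
    ∃ c' : ℤ → Fin (n + 5) → Bool,
      IsPeriodicCode (n + 5) (2 * (N + (10 * ((N - 5) / 10) + 5)) : ℕ) c' := by
  have := h.staircase (a := ((N - 5) / 10 : ℕ)) (by positivity) (by omega)
  simpa using this

lemma three_rpow_step (n : ℕ) :
    (40 : ℝ) * 3 ^ ((0.6535 * ((n + 5 : ℕ) : ℝ) - 8) / 3) ≤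
      3.4 * (40 * 3 ^ ((0.6535 * (n : ℝ) - 8) / 3)) := by
  have h : (3 : ℝ) ^ ((11 : ℝ) / 10) ≤ 3.4 := by
    rw [← pow_le_pow_iff_left₀ (by positivity) (by norm_num) (show 10 ≠ 0 by norm_num),
      ← Real.rpow_mul_natCast (by norm_num),
      show (11 : ℝ) / 10 * (10 : ℕ) = (11 : ℕ) by norm_num, Real.rpow_natCast]
    norm_num
  have h2 : (3 : ℝ) ^ ((0.6535 * ((n + 5 : ℕ) : ℝ) - 8) / 3) ≤
      3 ^ ((11 : ℝ) / 10) * 3 ^ ((0.6535 * (n : ℝ) - 8) / 3) := by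
    rw [← Real.rpow_add (by norm_num)]
    apply Real.rpow_le_rpow_of_exponent_le (by norm_num)
    push_cast
    linarith
  have h3 : (0 : ℝ) < 3 ^ ((0.6535 * (n : ℝ) - 8) / 3) := by positivity
  nlinarith

lemma forty_mul_three_rpow_le {x b : ℝ} (p : ℤ) (q : ℕ) (hq : 0 < q) (hb : 0 < b) (hx : x * q ≤ p)
    (h : (40 : ℝ) ^ q * 3 ^ p ≤ b ^ q) : 40 * (3 : ℝ) ^ x ≤ b := by
  rw [← pow_le_pow_iff_left₀ (by positivity) hb.le hq.ne', mul_pow]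
  refine le_trans ?_ h
  gcongr
  rw [← Real.rpow_mul_natCast (by norm_num), ← Real.rpow_intCast]
  exact Real.rpow_le_rpow_of_exponent_le (by norm_num) hx

lemma exists_long_isPeriodicCode (n : ℕ) (hn : 10 ≤ n) :
    ∃ (N : ℕ) (c : ℤ → Fin n → Bool), IsPeriodicCode n N c ∧ 30 ≤ N ∧
      (40 : ℝ) * 3 ^ ((0.6535 * (n : ℝ) - 8) / 3) ≤ N := by
  induction n using Nat.strong_induction_on with
  | _ n ih =>
    rcases lt_or_ge n 15 with h15 | h15
    · interval_cases n
      · obtain ⟨c, hc⟩ := cyclicFlip_five.exists_longer (by norm_num)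
        exact ⟨_, c, hc, by norm_num, forty_mul_three_rpow_le (-1) 3 (by norm_num) (by norm_num)
          (by norm_num) (by norm_num)⟩
      · obtain ⟨c, hc⟩ := cyclicFlip_six.exists_longer (by norm_num)
        exact ⟨_, c, hc, by norm_num, forty_mul_three_rpow_le (-1) 5 (by norm_num) (by norm_num)
          (by norm_num) (by norm_num)⟩
      · obtain ⟨c, hc⟩ := cyclicFlip_seven.exists_longer (by norm_num)
        exact ⟨_, c, hc, by norm_num, forty_mul_three_rpow_le (-1) 20 (by norm_num) (by norm_num)
          (by norm_num) (by norm_num)⟩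
      · obtain ⟨c, hc⟩ := cyclicFlip_eight.exists_longer (by norm_num)
        exact ⟨_, c, hc, by norm_num, forty_mul_three_rpow_le 1 5 (by norm_num) (by norm_num)
          (by norm_num) (by norm_num)⟩
      · obtain ⟨c, hc⟩ := cyclicFlip_nine.exists_longer (by norm_num)
        exact ⟨_, c, hc, by norm_num, forty_mul_three_rpow_le 2 5 (by norm_num) (by norm_num)
          (by norm_num) (by norm_num)⟩
    · obtain ⟨m, rfl⟩ : ∃ m, n = m + 5 := ⟨n - 5, by omega⟩
      obtain ⟨N, c, hc, hN, hle⟩ := ih m (by omega) (by omega)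
      obtain ⟨c', hc'⟩ := hc.exists_longer (by omega)
      refine ⟨_, c', hc', by omega, (three_rpow_step m).trans ?_⟩
      have h1 : 4 * N ≤ 2 * (N + (10 * ((N - 5) / 10) + 5)) + 18 := by omega
      have h2 : (4 : ℝ) * N ≤ (2 * (N + (10 * ((N - 5) / 10) + 5)) : ℕ) + 18 := by
        exact_mod_cast h1
      have h3 : (30 : ℝ) ≤ N := by exact_mod_cast hN
      linarith

theorem stmt_2 (n : ℕ) (hn : 6 ≤ ⌊(0.6535 : ℝ) * n⌋₊) :
    (40 : ℝ) * 3 ^ (((⌊(0.6535 : ℝ) * n⌋₊ : ℝ) - 8) / 3) ≤ (K n 4 : ℝ) := by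
  have hfl : (⌊(0.6535 : ℝ) * n⌋₊ : ℝ) ≤ 0.6535 * n := Nat.floor_le (by positivity)
  have hn10 : 10 ≤ n := by
    have h6 : (6 : ℝ) ≤ (⌊(0.6535 : ℝ) * n⌋₊ : ℝ) := by exact_mod_cast hn
    by_contra! hlt
    have : (n : ℝ) ≤ 9 := by exact_mod_cast Nat.le_of_lt_succ hlt
    linarith
  obtain ⟨N, c, hc, hN, hle⟩ := exists_long_isPeriodicCode n hn10
  have hK : (N : ℝ) ≤ K n 4 := by
    exact_mod_cast le_K (hc.existsCircuitCode (by omega))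
  refine le_trans ?_ (hle.trans hK)
  gcongr
  norm_num
end

section
/- (Klee) Let k ≥ 1 and let C = (x_1, …, x_N) be a cyclic sequence of N ≥ 2k distinct vertices of I(n) forming an induced cycle (cyclically consecutive vertices have Hamming distance 1 and non-consecutive vertices are non-adjacent). Then C is an (n,k) circuit code if and only if for all vertices x, x' of C, d_C(x, x') ≥ k implies d_H(x, x') ≥ k, where d_H is Hamming distance and d_C is the cyclic distance along C. -/
/-- `C` is an induced cycle of length `N` in the hypercube `I(n)`. -/
structure IsInducedCycle (n N : ℕ) (C : ZMod N → (Fin n → Bool)) : Prop where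
  inj : Function.Injective C
  adj : ∀ i : ZMod N, hammingDist (C i) (C (i + 1)) = 1
  induced : ∀ i j : ZMod N, i ≠ j → j ≠ i + 1 → i ≠ j + 1 →
    hammingDist (C i) (C j) ≠ 1

theorem cycDist_add_natCast {N k : ℕ} (hk : 1 ≤ k) (hN : 2 * k ≤ N) (i : ZMod N) :
    cycDist i (i + k) = k := by
  have : NeZero N := ⟨by omega⟩
  have hval : (k : ZMod N).val = k := ZMod.val_cast_of_lt (by omega)
  have hne : (k : ZMod N) ≠ 0 := fun h => by simp [h] at hval; omega
  have hneg : (-(k : ZMod N)).val = N - k := by rw [ZMod.neg_val, if_neg hne, hval]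
  rw [cycDist, add_sub_cancel_left, sub_add_cancel_left, hval, hneg]
  omega

/-- Some representative of the shorter arc joins the two positions. -/
theorem eq_add_cycDist_or {N : ℕ} [NeZero N] (i j : ZMod N) :
    j = i + (cycDist i j : ℕ) ∨ i = j + (cycDist i j : ℕ) := by
  rcases min_choice (j - i).val (i - j).val with h | h
  · left; rw [cycDist, h]; simp
  · right; rw [cycDist, h]; simp

theorem hammingDist_add_natCast_le {n N : ℕ} {C : ZMod N → (Fin n → Bool)}
    (hadj : ∀ i : ZMod N, hammingDist (C i) (C (i + 1)) = 1) (i : ZMod N) (m : ℕ) :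
    hammingDist (C i) (C (i + m)) ≤ m := by
  induction m with
  | zero => simp
  | succ m ih =>
    have h := hammingDist_triangle (C i) (C (i + m)) (C (i + m + 1))
    rw [hadj] at h
    push_cast
    rw [← add_assoc]
    omega

/-- Short arcs of a closed walk are geodesic if arcs of length `k` are. -/
theorem hammingDist_add_natCast_eq {n N k : ℕ} {C : ZMod N → (Fin n → Bool)}
    (hadj : ∀ i : ZMod N, hammingDist (C i) (C (i + 1)) = 1) {i : ZMod N}
    (hik : k ≤ hammingDist (C i) (C (i + k))) {m : ℕ} (hm : m ≤ k) :
    hammingDist (C i) (C (i + m)) = m := by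
  have h₁ := hammingDist_add_natCast_le hadj i m
  have h₂ := hammingDist_add_natCast_le hadj (i + m) (k - m)
  have h₃ := hammingDist_triangle (C i) (C (i + m)) (C (i + k))
  rw [add_assoc, ← Nat.cast_add, Nat.add_sub_cancel' hm] at h₂
  omega

theorem stmt_3 (n k N : ℕ) (hk : 1 ≤ k) (hN : 2 * k ≤ N)
    (C : ZMod N → (Fin n → Bool)) (hC : IsInducedCycle n N C) :
    IsCircuitCode n k N C ↔
      ∀ i j : ZMod N, k ≤ cycDist i j → k ≤ hammingDist (C i) (C j) := by
  have : NeZero N := ⟨by omega⟩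
  constructor
  · intro h i j hij
    by_contra! hlt
    have := h.spread i j hlt
    omega
  · intro h
    refine ⟨hC.inj, hC.adj, hC.induced, fun i j hij => ?_⟩
    have hlt : cycDist i j < k := by
      by_contra! hle
      exact absurd (h i j hle) (by omega)
    have geodesic (a : ZMod N) :
        hammingDist (C a) (C (a + (cycDist i j : ℕ))) = cycDist i j :=
      hammingDist_add_natCast_eq hC.adj
        (h a (a + k) (cycDist_add_natCast hk hN a).ge) hlt.le
    rcases eq_add_cycDist_or i j with hj | hi
    · have := geodesic i
      rw [← hj] at this
      exact this.symm
    · have := geodesic j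
      rw [← hi, hammingDist_comm] at this
      exact this.symm
end

section
/- (Singleton) If there exists an (n,k) circuit code of length N with k ≥ 3, then there exists an (n+2, k) circuit code of length N + 4⌊N/(2(k−1))⌋. -/
theorem cycDist_comm {N : ℕ} (i j : ZMod N) : cycDist i j = cycDist j i :=
  min_comm _ _

theorem cycDist_natCast_add {N : ℕ} (hN : 0 < N) (x r : ℕ) (hr : r ≤ N) :
    cycDist (x : ZMod N) ((x + r : ℕ) : ZMod N) = min r (N - r) := by
  have h1 : ((x + r : ℕ) : ZMod N) - (x : ZMod N) = (r : ZMod N) := by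
    push_cast; ring
  have h2 : (x : ZMod N) - ((x + r : ℕ) : ZMod N) = ((N - r : ℕ) : ZMod N) := by
    rw [Nat.cast_sub hr]; push_cast; simp
  rw [cycDist, h1, h2, ZMod.val_natCast, ZMod.val_natCast]
  rcases Nat.eq_zero_or_pos r with rfl | h0
  · simp
  rcases hr.eq_or_lt with rfl | h
  · simp
  rw [Nat.mod_eq_of_lt h, Nat.mod_eq_of_lt (by omega)]

theorem hammingDist_finCons {n : ℕ} (a b : Bool) (x y : Fin n → Bool) :
    hammingDist (Fin.cons a x : Fin (n + 1) → Bool) (Fin.cons b y) =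
      (if a = b then 0 else 1) + hammingDist x y := by
  simp only [hammingDist, Finset.card_filter, Fin.sum_univ_succ, Fin.cons_zero, Fin.cons_succ]
  split_ifs <;> simp_all

/-- A closed walk of period `M` whose points satisfy the spread condition is a circuit code. -/
theorem isCircuitCode_of_adj_of_spread {n k M : ℕ} (hk : 2 ≤ k) (hM : 0 < M)
    (C : ZMod M → (Fin n → Bool))
    (adj : ∀ i : ZMod M, hammingDist (C i) (C (i + 1)) = 1)
    (spread : ∀ i j : ZMod M, hammingDist (C i) (C j) < k →
      cycDist i j = hammingDist (C i) (C j)) : IsCircuitCode n k M C := by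
  have : NeZero M := ⟨hM.ne'⟩
  refine ⟨fun i j hij => ?_, adj, fun i j _ h1 h2 h => ?_, spread⟩
  · have h0 : hammingDist (C i) (C j) = 0 := by rw [hij]; exact hammingDist_self _
    have h := spread i j (by omega)
    rw [h0, cycDist] at h
    rcases min_choice (j - i).val (i - j).val with h' | h' <;> rw [h', ZMod.val_eq_zero] at h
    · exact (sub_eq_zero.mp h).symm
    · exact sub_eq_zero.mp h
  · have h' := spread i j (by omega)
    rw [h, cycDist] at h'
    rcases min_choice (j - i).val (i - j).val with hc | hc <;> rw [hc] at h'
    · apply h1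
      have := ZMod.natCast_zmod_val (j - i)
      rw [h', Nat.cast_one] at this
      rw [this]; ring
    · apply h2
      have := ZMod.natCast_zmod_val (i - j)
      rw [h', Nat.cast_one] at this
      rw [this]; ring

/-- The number of the `4 * m` insertions made during the first `t` steps of a cycle of
length `M`. -/
def insertions (m M t : ℕ) : ℕ := 4 * m * t / M

theorem insertions_add_period {m M : ℕ} (hM : 0 < M) (t : ℕ) :
    insertions m M (t + M) = insertions m M t + 4 * m := by
  rw [insertions, mul_add, Nat.add_mul_div_right _ _ hM, insertions]

theorem insertions_mono (m M : ℕ) : Monotone (insertions m M) := fun _ _ h =>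
  Nat.div_le_div_right (Nat.mul_le_mul_left _ h)

theorem insertions_succ_le {m M : ℕ} (hM : 0 < M) (h : 4 * m ≤ M) (t : ℕ) :
    insertions m M (t + 1) ≤ insertions m M t + 1 := by
  rw [insertions, insertions, ← Nat.add_div_right _ hM]
  exact Nat.div_le_div_right (by rw [mul_add]; omega)

theorem insertions_le_self {m M : ℕ} (hM : 0 < M) (h : 4 * m ≤ M) (t : ℕ) :
    insertions m M t ≤ t :=
  (Nat.div_le_div_right (Nat.mul_le_mul_right t h)).trans (Nat.mul_div_cancel_left t hM).le

theorem insertions_add_lt {m M : ℕ} (hM : 0 < M) (s L e : ℕ)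
    (he : insertions m M (s + L) = insertions m M s + (e + 1)) : e * M < 4 * m * L := by
  have h1 : insertions m M (s + L) * M ≤ 4 * m * (s + L) := Nat.div_mul_le_self _ _
  have h2 : 4 * m * s < M * (insertions m M s + 1) := Nat.lt_mul_div_succ _ hM
  rw [he] at h1
  nlinarith

/-- An arc with `r` original steps, where `r < k`, contains at most three insertions, and at
most two if `r < k - 1`. -/
theorem insertions_bound {m M k : ℕ} (hk : 3 ≤ k) (hM : 0 < M) (h : 2 * m * (k + 1) ≤ M)
    (s r e : ℕ) (hr : r < k)
    (he : insertions m M (s + (r + e)) = insertions m M s + e) :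
    e ≤ 2 ∨ e = 3 ∧ r + 1 = k := by
  obtain ⟨k, rfl⟩ := Nat.exists_eq_add_of_le' hk
  rcases Nat.lt_or_ge 2 e with h3 | h3
  swap
  · exact Or.inl h3
  obtain ⟨e, rfl⟩ := Nat.exists_eq_add_of_le' h3
  right
  have h1 := insertions_add_lt hM s _ _ he
  have h2 : (e + 2) * (2 * m * (k + 3 + 1)) < 4 * m * (r + (e + 3)) :=
    (Nat.mul_le_mul_left _ h).trans_lt h1
  have h4 : (e + 2) * (k + 4) < 2 * (r + (e + 3)) := by
    refine Nat.lt_of_mul_lt_mul_left (a := 2 * m) ?_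
    calc 2 * m * ((e + 2) * (k + 4)) = (e + 2) * (2 * m * (k + 3 + 1)) := by ring
      _ < 4 * m * (r + (e + 3)) := h2
      _ = _ := by ring
  have he0 : e = 0 := by
    by_contra hne
    have : 1 ≤ e := by omega
    nlinarith [Nat.mul_le_mul_right k this]
  subst he0
  omega

/-- The vertex reached after `t` steps, when the two new coordinates are flipped alternately
at the `4 * m` insertions. -/
def stretch {n N : ℕ} (C : ZMod N → (Fin n → Bool)) (m M t : ℕ) : Fin (n + 2) → Bool :=
  Fin.cons (decide ((insertions m M t + 1) / 2 % 2 = 1))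
    (Fin.cons (decide (insertions m M t / 2 % 2 = 1)) (C ((t - insertions m M t : ℕ) : ZMod N)))

theorem hammingDist_stretch {n N : ℕ} (C : ZMod N → (Fin n → Bool)) (m M s t : ℕ) :
    hammingDist (stretch C m M s) (stretch C m M t) =
      (if (insertions m M s + 1) / 2 % 2 = (insertions m M t + 1) / 2 % 2 then 0 else 1) +
      ((if insertions m M s / 2 % 2 = insertions m M t / 2 % 2 then 0 else 1) +
      hammingDist (C ((s - insertions m M s : ℕ) : ZMod N))
        (C ((t - insertions m M t : ℕ) : ZMod N))) := by
  rw [stretch, stretch, hammingDist_finCons, hammingDist_finCons]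
  simp only [decide_eq_decide]
  split_ifs <;> omega

theorem stretch_periodic {n N : ℕ} (C : ZMod N → (Fin n → Bool)) (m : ℕ) (hN : 0 < N) :
    Function.Periodic (stretch C m (N + 4 * m)) (N + 4 * m) := by
  intro t
  have hle := insertions_le_self (m := m) (M := N + 4 * m) (by omega) (by omega) t
  have h := insertions_add_period (m := m) (M := N + 4 * m) (by omega) t
  rw [stretch, stretch, h]
  have h1 : t + (N + 4 * m) - (insertions m (N + 4 * m) t + 4 * m) =
      t - insertions m (N + 4 * m) t + N := by omega
  have h2 : (insertions m (N + 4 * m) t + 4 * m + 1) / 2 % 2 =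
      (insertions m (N + 4 * m) t + 1) / 2 % 2 := by omega
  have h3 : (insertions m (N + 4 * m) t + 4 * m) / 2 % 2 =
      insertions m (N + 4 * m) t / 2 % 2 := by omega
  rw [h1, h2, h3, Nat.cast_add, ZMod.natCast_self, add_zero]

theorem hammingDist_stretch_succ {n N : ℕ} (C : ZMod N → (Fin n → Bool))
    (adj : ∀ i : ZMod N, hammingDist (C i) (C (i + 1)) = 1) (m M : ℕ) (hM : 0 < M)
    (h : 4 * m ≤ M) (t : ℕ) :
    hammingDist (stretch C m M t) (stretch C m M (t + 1)) = 1 := by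
  have hle := insertions_le_self hM h t
  have h1 := insertions_succ_le hM h t
  have h2 := insertions_mono m M t.le_succ
  rw [hammingDist_stretch]
  rcases (show insertions m M (t + 1) = insertions m M t ∨
      insertions m M (t + 1) = insertions m M t + 1 by grind) with h3 | h3 <;> rw [h3]
  · rw [Nat.sub_add_comm hle, Nat.cast_add, Nat.cast_one, adj]
    simp
  · rw [Nat.add_sub_add_right, hammingDist_self]
    split_ifs <;> omega

theorem hammingDist_le_of_adj {n : ℕ} (F : ℕ → (Fin n → Bool))
    (adj : ∀ t, hammingDist (F t) (F (t + 1)) = 1) (s L : ℕ) :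
    hammingDist (F s) (F (s + L)) ≤ L := by
  induction L with
  | zero => simp
  | succ L ih =>
    have h := hammingDist_triangle (F s) (F (s + L)) (F (s + L + 1))
    rw [adj] at h
    rw [← add_assoc]
    omega

/-- If the underlying arc of `C` is as long as the distance between its ends and the ends of the
stretched arc are at distance less than `k`, then the stretched arc has the same property. -/
theorem hammingDist_stretch_eq {n N k : ℕ} (C : ZMod N → (Fin n → Bool)) (m M : ℕ)
    (hk : 3 ≤ k) (hM : 0 < M) (h4 : 4 * m ≤ M) (h : 2 * m * (k + 1) ≤ M) (s r e : ℕ)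
    (he : insertions m M (s + (r + e)) = insertions m M s + e)
    (hr : hammingDist (C ((s - insertions m M s : ℕ) : ZMod N))
      (C ((s - insertions m M s + r : ℕ) : ZMod N)) = r)
    (hlt : hammingDist (stretch C m M s) (stretch C m M (s + (r + e))) < k) :
    hammingDist (stretch C m M s) (stretch C m M (s + (r + e))) = r + e := by
  have hle := insertions_le_self hM h4 s
  have hp : s + (r + e) - (insertions m M s + e) = s - insertions m M s + r := by omega
  rw [hammingDist_stretch, he, hp, hr] at hlt ⊢
  rcases insertions_bound hk hM h s r e (by omega) he with h5 | ⟨rfl, h5⟩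
  · interval_cases e <;> split_ifs at hlt ⊢ <;> omega
  · exfalso
    split_ifs at hlt <;> omega

theorem cycDist_stretch {n N k m : ℕ} (C : ZMod N → (Fin n → Bool)) (hC : IsCircuitCode n k N C)
    (hk : 3 ≤ k) (hN : 0 < N) (h : 2 * m * (k + 1) ≤ N + 4 * m) (s L : ℕ) (hL : L ≤ N + 4 * m)
    (hlt : hammingDist (stretch C m (N + 4 * m) s) (stretch C m (N + 4 * m) (s + L)) < k) :
    min L (N + 4 * m - L) =
      hammingDist (stretch C m (N + 4 * m) s) (stretch C m (N + 4 * m) (s + L)) := by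
  have hM : 0 < N + 4 * m := by omega
  have h4 : 4 * m ≤ N + 4 * m := by omega
  have hper := stretch_periodic C m hN
  have hcper := insertions_add_period (m := m) hM s
  have adj := hammingDist_stretch_succ C hC.adj m (N + 4 * m) hM h4
  have hsum : s + L + (N + 4 * m - L) = s + (N + 4 * m) := by omega
  have hle1 := hammingDist_le_of_adj _ adj s L
  have hle2 := hammingDist_le_of_adj _ adj (s + L) (N + 4 * m - L)
  rw [hsum, hper s, hammingDist_comm] at hle2
  have key := hammingDist_stretch_eq C m (N + 4 * m) hk hM h4 h
  have step (a l : ℕ) : ∃ r e, l = r + e ∧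
      insertions m (N + 4 * m) (a + l) = insertions m (N + 4 * m) a + e := by
    have h1 := insertions_mono m (N + 4 * m) (Nat.le_add_right a l)
    have h2 : insertions m (N + 4 * m) (a + l) ≤ insertions m (N + 4 * m) a + l := by
      clear * - hM h4
      induction l with
      | zero => simp
      | succ l ih =>
        have := insertions_succ_le hM h4 (a + l)
        rw [← add_assoc]
        omega
    exact ⟨l - (insertions m (N + 4 * m) (a + l) - insertions m (N + 4 * m) a),
      insertions m (N + 4 * m) (a + l) - insertions m (N + 4 * m) a, by omega, by omega⟩
  obtain ⟨r, e, rfl, he⟩ := step s L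
  obtain ⟨r', e', hL', he'⟩ := step (s + (r + e)) (N + 4 * m - (r + e))
  have hle := insertions_le_self hM h4 s
  have hee : e + e' = 4 * m := by
    rw [hsum, hcper] at he'
    omega
  have hrr : r + r' = N := by omega
  have hp : s + (r + e) - (insertions m (N + 4 * m) s + e) =
    s - insertions m (N + 4 * m) s + r := by omega
  have hd : hammingDist (C ((s - insertions m (N + 4 * m) s : ℕ) : ZMod N))
      (C ((s - insertions m (N + 4 * m) s + r : ℕ) : ZMod N)) < k := by
    refine lt_of_le_of_lt ?_ hlt
    rw [hammingDist_stretch, he, hp]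
    omega
  have hcyc := hC.spread _ _ hd
  rw [cycDist_natCast_add hN _ _ (by omega)] at hcyc
  rcases le_total r (N - r) with hmin | hmin
  · rw [min_eq_left hmin] at hcyc
    have := key s r e he hcyc.symm hlt
    omega
  · rw [min_eq_right hmin] at hcyc
    rw [hL'] at he' hsum
    have := key (s + (r + e)) r' e' he' (by
      rw [he, hp, hammingDist_comm, add_assoc, hrr, Nat.cast_add _ N, ZMod.natCast_self, add_zero]
      omega) (by rwa [hsum, hper s, hammingDist_comm])
    rw [hsum, hper s, hammingDist_comm] at this
    omega

theorem stmt_7 (n k N : ℕ) (hk : 3 ≤ k) (h : ExistsCircuitCode n k N) :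
    ExistsCircuitCode (n + 2) k (N + 4 * (N / (2 * (k - 1)))) := by
  obtain ⟨C, hC⟩ := h
  have hN : 0 < N := by
    rcases Nat.eq_zero_or_pos N with rfl | h
    · exact absurd hC.inj (not_injective_infinite_finite (α := ℤ) C)
    · exact h
  have hm : 2 * (N / (2 * (k - 1))) * (k + 1) ≤ N + 4 * (N / (2 * (k - 1))) := by
    have h1 := Nat.div_mul_le_self N (2 * (k - 1))
    obtain ⟨k, rfl⟩ := Nat.exists_eq_add_of_le' hk
    rw [show k + 3 - 1 = k + 2 by omega] at *
    linarith
  generalize N / (2 * (k - 1)) = m at hm ⊢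
  have hM : 0 < N + 4 * m := by omega
  have : NeZero (N + 4 * m) := ⟨hM.ne'⟩
  have hper := stretch_periodic C m hN
  refine ⟨fun i => stretch C m (N + 4 * m) i.val,
    isCircuitCode_of_adj_of_spread (by omega) hM _ (fun i => ?_) fun i j => ?_⟩
  · have h1 : (i + 1).val = (i.val + 1) % (N + 4 * m) := by
      rw [← ZMod.val_natCast, Nat.cast_add, ZMod.natCast_zmod_val, Nat.cast_one]
    simp only [h1, hper.map_mod_nat]
    exact hammingDist_stretch_succ C hC.adj m _ hM (by omega) _
  · wlog hij : i.val ≤ j.val generalizing i j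
    · rw [cycDist_comm, hammingDist_comm]
      exact this j i (by omega)
    obtain ⟨L, hL⟩ := Nat.exists_eq_add_of_le hij
    have hj := j.val_lt
    intro hlt
    simp only [hL] at hlt ⊢
    rw [← cycDist_stretch C hC hk hN hm _ _ (by omega) hlt,
      ← cycDist_natCast_add hM i.val L (by omega), ← hL, ZMod.natCast_zmod_val,
      ZMod.natCast_zmod_val]
end
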